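/- Suppose R satisfies the curvature-type symmetries and the q-invariance R(qx,qy,qz,qu) = R(x,y,z,u). Let x ∈ ℝ³ be such that {x, qx, q²x} is an orthonormal basis with respect to g, let u ∈ ℝ³ induce a q-basis with g(u,u) = 1, and let y ∈ ℝ³ induce a q-basis with g(y,y) = 1 and g(y, qy) = −1/2 (i.e. ∠(y,qy) = 2π/3). Set c = g(u, qu). Then μ(u, qu) = ((1+2c)/(1−c))·μ(x, qx) − (3c/(1−c))·μ(y, qy). -/

import Mathlib

/-- The metric `g` determined by the circulant matrix with rows `(A,B,B),(B,A,B),(B,B,A)`. -/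
def g (A B : ℝ) (x y : Fin 3 → ℝ) : ℝ :=
  A * (x 0 * y 0 + x 1 * y 1 + x 2 * y 2) +
    B * (x 0 * y 1 + x 0 * y 2 + x 1 * y 0 + x 1 * y 2 + x 2 * y 0 + x 2 * y 1)

/-- The structure `q`, given by `q(x¹,x²,x³) = (-x²,-x³,-x¹)`, with `q³ = -id`. -/
def q (x : Fin 3 → ℝ) : Fin 3 → ℝ := ![-(x 1), -(x 2), -(x 0)]

/-- The sectional curvature of the 2-plane spanned by `x, y`. -/
noncomputable def sec (A B : ℝ) (R : MultilinearMap ℝ (fun _ : Fin 4 => Fin 3 → ℝ) ℝ)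
    (x y : Fin 3 → ℝ) : ℝ :=
  R ![x, y, x, y] / (g A B x x * g A B y y - (g A B x y) ^ 2)

section

variable {R : MultilinearMap ℝ (fun _ : Fin 4 => Fin 3 → ℝ) ℝ}

/-- Expansion of a multilinear form on `ℝ³` in its first argument. -/
lemma map_expand_fst (x y z u : Fin 3 → ℝ) :
    R ![x, y, z, u] = x 0 * R ![![1, 0, 0], y, z, u] + x 1 * R ![![0, 1, 0], y, z, u] +
      x 2 * R ![![0, 0, 1], y, z, u] := by
  have hadd (a b : Fin 3 → ℝ) : R ![a + b, y, z, u] = R ![a, y, z, u] + R ![b, y, z, u] :=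
    R.cons_add ![y, z, u] a b
  have hsmul (t : ℝ) (a : Fin 3 → ℝ) : R ![t • a, y, z, u] = t * R ![a, y, z, u] :=
    R.cons_smul ![y, z, u] t a
  rw [← hsmul, ← hsmul, ← hsmul, ← hadd, ← hadd]
  congr 2
  ext i
  fin_cases i <;> simp

/-- A form that is skew-symmetric in its first two arguments depends on them only through the
coordinates of their wedge product. -/
lemma map_expand_wedge (hsym1 : ∀ x y z u : Fin 3 → ℝ, R ![x, y, z, u] = -R ![y, x, z, u])
    (x y z u : Fin 3 → ℝ) :
    R ![x, y, z, u] =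
      (x 1 * y 2 - x 2 * y 1) * R ![![0, 1, 0], ![0, 0, 1], z, u] +
      (x 2 * y 0 - x 0 * y 2) * R ![![0, 0, 1], ![1, 0, 0], z, u] +
      (x 0 * y 1 - x 1 * y 0) * R ![![1, 0, 0], ![0, 1, 0], z, u] := by
  have hsnd (w : Fin 3 → ℝ) : R ![w, y, z, u] = -(y 0 * R ![![1, 0, 0], w, z, u] +
      y 1 * R ![![0, 1, 0], w, z, u] + y 2 * R ![![0, 0, 1], w, z, u]) := by
    rw [hsym1, map_expand_fst]
  rw [map_expand_fst, hsnd, hsnd, hsnd]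
  linear_combination
    (-(x 0 * y 0) / 2) * hsym1 ![1, 0, 0] ![1, 0, 0] z u
    - (x 1 * y 1) / 2 * hsym1 ![0, 1, 0] ![0, 1, 0] z u
    - (x 2 * y 2) / 2 * hsym1 ![0, 0, 1] ![0, 0, 1] z u
    - (x 0 * y 1) * hsym1 ![0, 1, 0] ![1, 0, 0] z u
    - (x 1 * y 2) * hsym1 ![0, 0, 1] ![0, 1, 0] z u
    - (x 2 * y 0) * hsym1 ![1, 0, 0] ![0, 0, 1] z u

/-- A `q`-invariant curvature-type form on `v, qv` is determined by two of its components. -/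
lemma map_self_q (hsym1 : ∀ x y z u : Fin 3 → ℝ, R ![x, y, z, u] = -R ![y, x, z, u])
    (hsym3 : ∀ x y z u : Fin 3 → ℝ, R ![x, y, z, u] = R ![z, u, x, y])
    (hq : ∀ x y z u : Fin 3 → ℝ, R ![q x, q y, q z, q u] = R ![x, y, z, u]) :
    ∃ P S : ℝ, ∀ v : Fin 3 → ℝ, R ![v, q v, v, q v] =
      (v 0 ^ 2 + v 1 ^ 2 + v 2 ^ 2 - (v 0 * v 1 + v 1 * v 2 + v 2 * v 0)) *
        (P * (v 0 ^ 2 + v 1 ^ 2 + v 2 ^ 2 + (v 0 * v 1 + v 1 * v 2 + v 2 * v 0)) -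
          2 * S * (v 0 * v 1 + v 1 * v 2 + v 2 * v 0)) := by
  have hexp (x y z u : Fin 3 → ℝ) := map_expand_wedge hsym1 x y z u
  set e₀ : Fin 3 → ℝ := ![1, 0, 0] with he₀
  set e₁ : Fin 3 → ℝ := ![0, 1, 0] with he₁
  set e₂ : Fin 3 → ℝ := ![0, 0, 1] with he₂
  have hgram (x y z u : Fin 3 → ℝ) := hexp x y z u
  conv at hgram =>
    intro x y z u
    rw [hsym3 e₁ e₂ z u, hsym3 e₂ e₀ z u, hsym3 e₀ e₁ z u, hexp z u e₁, hexp z u e₂, hexp z u e₀]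
  have hq₁ := hq e₁ e₂ e₁ e₂
  have hq₂ := hq e₂ e₀ e₂ e₀
  have hq₃ := hq e₁ e₂ e₂ e₀
  have hq₄ := hq e₂ e₀ e₀ e₁
  rw [hgram] at hq₁ hq₂ hq₃ hq₄
  simp [q, he₀, he₁, he₂] at hq₁ hq₂ hq₃ hq₄
  simp only [← he₀, ← he₁, ← he₂] at hq₁ hq₂ hq₃ hq₄
  refine ⟨R ![e₁, e₂, e₁, e₂], R ![e₁, e₂, e₂, e₀], fun v => ?_⟩
  rw [hgram]
  simp only [q, Matrix.cons_val]
  rw [hsym3 e₀ e₁ e₁ e₂, hsym3 e₂ e₀ e₁ e₂, hsym3 e₀ e₁ e₂ e₀, hq₁, ← hq₂, hq₃, ← hq₄,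
    hsym3 e₂ e₀ e₁ e₂]
  ring

/-- The sectional curvature of the plane of a unit vector `v` and `qv` is a function of `g(v,qv)`
alone, whose product with `1 - g(v,qv)` is affine. -/
lemma sec_self_q {A B : ℝ} (hAB : A > B) (hB : B > 0)
    (hsym1 : ∀ x y z u : Fin 3 → ℝ, R ![x, y, z, u] = -R ![y, x, z, u])
    (hsym3 : ∀ x y z u : Fin 3 → ℝ, R ![x, y, z, u] = R ![z, u, x, y])
    (hq : ∀ x y z u : Fin 3 → ℝ, R ![q x, q y, q z, q u] = R ![x, y, z, u]) :
    ∃ k l : ℝ, ∀ v : Fin 3 → ℝ, g A B v v = 1 → 1 + g A B v (q v) ≠ 0 →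
      sec A B R v (q v) = (k + l * g A B v (q v)) / (1 - g A B v (q v)) := by
  obtain ⟨P, S, hPS⟩ := map_self_q hsym1 hsym3 hq
  have h₁ : A - B ≠ 0 := by linarith
  have h₂ : A + 2 * B ≠ 0 := by linarith
  refine ⟨(A - B)⁻¹ / 3 * (P * (2 * (A + 2 * B)⁻¹ + (A - B)⁻¹) -
      2 * S * ((A + 2 * B)⁻¹ - (A - B)⁻¹)),
    (A - B)⁻¹ / 3 * (P * (-4 * (A + 2 * B)⁻¹ + (A - B)⁻¹) +
      2 * S * (2 * (A + 2 * B)⁻¹ + (A - B)⁻¹)), fun v hv hc => ?_⟩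
  have hqq : g A B (q v) (q v) = 1 := by
    rw [← hv]
    simp only [g, q, Matrix.cons_val]
    ring
  rw [sec, hPS, hv, hqq]
  set c := g A B v (q v) with hcdef
  set Q := v 0 ^ 2 + v 1 ^ 2 + v 2 ^ 2 with hQ
  set E := v 0 * v 1 + v 1 * v 2 + v 2 * v 0 with hE
  have hv' : A * Q + 2 * B * E = 1 := by
    rw [← hv, hQ, hE, g]
    ring
  have hc' : A * E + B * (Q + E) = -c := by
    rw [hcdef, hQ, hE]
    simp only [g, q, Matrix.cons_val]
    ring
  have hsub : Q - E = (1 + c) * (A - B)⁻¹ := by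
    field_simp
    linear_combination hv' - hc'
  have hadd : Q + 2 * E = (1 - 2 * c) * (A + 2 * B)⁻¹ := by
    field_simp
    linear_combination hv' + 2 * hc'
  have hcc : 1 - c ≠ 0 := by
    have : 0 ≤ (1 - 2 * c) * (A + 2 * B)⁻¹ := by
      rw [← hadd, show Q + 2 * E = (v 0 + v 1 + v 2) ^ 2 by rw [hQ, hE]; ring]
      positivity
    have := nonneg_of_mul_nonneg_left this (inv_pos.2 (by linarith))
    linarith
  generalize (A - B)⁻¹ = D at *
  generalize (A + 2 * B)⁻¹ = D' at *
  have hE' : E = ((1 - 2 * c) * D' - (1 + c) * D) / 3 := by linarith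
  have hQ' : Q = ((1 - 2 * c) * D' + 2 * (1 + c) * D) / 3 := by linarith
  rw [hE', hQ', show (1 : ℝ) * 1 - c ^ 2 = (1 + c) * (1 - c) by ring]
  field_simp
  ring

/-- A unit vector `v` inducing a `q`-basis satisfies `g(v,qv) ≠ -1`. -/
lemma one_add_ne_zero_of_linearIndependent {A B : ℝ} (hAB : A > B) {v : Fin 3 → ℝ}
    (hv : LinearIndependent ℝ ![v, q v, q (q v)]) (hvv : g A B v v = 1) :
    1 + g A B v (q v) ≠ 0 := by
  intro h
  have hsq : (A - B) * ((v 0 - v 1) ^ 2 + (v 1 - v 2) ^ 2 + (v 2 - v 0) ^ 2) = 0 := by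
    rw [← hvv] at h
    simp only [g, q, Matrix.cons_val] at h
    linear_combination 2 * h
  have hsq := (mul_eq_zero.1 hsq).resolve_left (by linarith)
  have h01 : v 0 = v 1 := by
    nlinarith [sq_nonneg (v 0 - v 1), sq_nonneg (v 1 - v 2), sq_nonneg (v 2 - v 0)]
  have h12 : v 1 = v 2 := by
    nlinarith [sq_nonneg (v 0 - v 1), sq_nonneg (v 1 - v 2), sq_nonneg (v 2 - v 0)]
  have hqq : q (q v) = v := by
    ext i
    fin_cases i <;> simp [q, h01, h12]
  have : (2 : Fin 3) = 0 := hv.injective (by simpa using hqq)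
  exact absurd this (by decide)

end

/-- if `{x,qx,q²x}` is `g`-orthonormal, `u` induces a `q`-basis with
`g(u,u) = 1`, and `y` induces a `q`-basis with `g(y,y) = 1`, `g(y,qy) = -1/2`
(i.e. `∠(y,qy) = 2π/3`), then with `c = g(u,qu)`,
`μ(u,qu) = ((1+2c)/(1-c))·μ(x,qx) - (3c/(1-c))·μ(y,qy)`. -/
theorem sectional_curvature_formula (A B : ℝ) (hAB : A > B) (hB : B > 0)
    (R : MultilinearMap ℝ (fun _ : Fin 4 => Fin 3 → ℝ) ℝ)
    (hsym1 : ∀ x y z u : Fin 3 → ℝ, R ![x, y, z, u] = -R ![y, x, z, u])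
    (hsym2 : ∀ x y z u : Fin 3 → ℝ, R ![x, y, z, u] = -R ![x, y, u, z])
    (hsym3 : ∀ x y z u : Fin 3 → ℝ, R ![x, y, z, u] = R ![z, u, x, y])
    (hq : ∀ x y z u : Fin 3 → ℝ, R ![q x, q y, q z, q u] = R ![x, y, z, u])
    (x u y : Fin 3 → ℝ)
    (hx1 : g A B x x = 1) (hx2 : g A B (q x) (q x) = 1)
    (hx3 : g A B (q (q x)) (q (q x)) = 1)
    (hx4 : g A B x (q x) = 0) (hx5 : g A B x (q (q x)) = 0)
    (hx6 : g A B (q x) (q (q x)) = 0)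
    (hu : LinearIndependent ℝ ![u, q u, q (q u)]) (huu : g A B u u = 1)
    (hy : LinearIndependent ℝ ![y, q y, q (q y)]) (hyy : g A B y y = 1)
    (hyqy : g A B y (q y) = -(1 / 2)) :
    sec A B R u (q u) =
      ((1 + 2 * g A B u (q u)) / (1 - g A B u (q u))) * sec A B R x (q x) -
        (3 * g A B u (q u) / (1 - g A B u (q u))) * sec A B R y (q y) := by
  obtain ⟨k, l, hkl⟩ := sec_self_q hAB hB hsym1 hsym3 hq
  rw [hkl u huu (one_add_ne_zero_of_linearIndependent hAB hu huu),
    hkl x hx1 (by rw [hx4]; norm_num),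
    hkl y hyy (one_add_ne_zero_of_linearIndependent hAB hy hyy), hx4, hyqy]
  generalize g A B u (q u) = c
  ring
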